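/- Let g : V → (−∞,∞] be lower semicontinuous with respect to the weak topology of V, and suppose its lower semicontinuous convex envelope g** is coercive. If x ∈ V satisfies g**(x) < ∞ and x is an extremal point of g** — that is, there is no unit vector ν ∈ V, t₀ > 0 and reals a, b with g**(x + tν) = a + bt for all t ∈ (−t₀, t₀) — then g(x) = g**(x) (equivalently, the point (x, g**(x)) belongs to the epigraph of g). -/

import Mathlib

variable {V : Type*} [NormedAddCommGroup V] [InnerProductSpace ℝ V] [CompleteSpace V]
  [TopologicalSpace.SeparableSpace V]

/-- The quadratic envelope `Q_γ(f)`: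
`Q_γ(f)(x) = sup { α − (γ/2)‖x−y‖² : α ∈ ℝ, y ∈ V, α − (γ/2)‖·−y‖² ≤ f }`. -/
noncomputable def Qenv (γ : ℝ) (f : V → EReal) (x : V) : EReal :=
  sSup {v : EReal | ∃ α : ℝ, ∃ y : V,
    (∀ z : V, ((α - γ / 2 * ‖z - y‖ ^ 2 : ℝ) : EReal) ≤ f z) ∧
      v = ((α - γ / 2 * ‖x - y‖ ^ 2 : ℝ) : EReal)}

/-- The transform `S_γ(f)(y) = sup_x ( −f(x) − (γ/2)‖x−y‖² )`. -/
noncomputable def Senv (γ : ℝ) (f : V → EReal) (y : V) : EReal :=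
  ⨆ x : V, (-(f x) - ((γ / 2 * ‖x - y‖ ^ 2 : ℝ) : EReal))

/-- Convexity for extended-real-valued functions. -/
def ERealConvex (g : V → EReal) : Prop :=
  ∀ x y : V, ∀ a b : ℝ, 0 ≤ a → 0 ≤ b → a + b = 1 →
    g (a • x + b • y) ≤ (a : EReal) * g x + (b : EReal) * g y

/-- The lower semicontinuous convex envelope: the (pointwise) greatest lower semicontinuous
convex minorant of `g`. -/
noncomputable def convEnv (g : V → EReal) (x : V) : EReal :=
  ⨆ h : {h : V → EReal // LowerSemicontinuous h ∧ ERealConvex h ∧ ∀ z, h z ≤ g z}, h.1 x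

/-- Lower semicontinuity with respect to the weak topology of `V`. -/
def WeaklyLSC (g : V → EReal) : Prop :=
  LowerSemicontinuous (fun x : WeakSpace ℝ V => g x)

/-- `h` is coercive iff all its sublevel sets are bounded. -/
def Coercive (h : V → EReal) : Prop :=
  ∀ c : ℝ, Bornology.IsBounded {x : V | h x ≤ (c : EReal)}

set_option linter.unusedSectionVars false

theorem t2weak : T2Space (WeakSpace ℝ V) := (NormedSpace.isEmbedding_inclusionInDoubleDualWeak ℝ V).t2Space

theorem choquet_slice {E : Type*} [AddCommGroup E] [Module ℝ E] [TopologicalSpace E]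
    [IsTopologicalAddGroup E] [ContinuousSMul ℝ E] [LocallyConvexSpace ℝ E] [T2Space E]
    {K : Set E} (hK : IsCompact K) (hKc : Convex ℝ K) {x : E} (hx : x ∈ K.extremePoints ℝ)
    {U : Set E} (hU : IsOpen U) (hxU : x ∈ U) :
    ∃ f : StrongDual ℝ E, ∃ u : ℝ, f x < u ∧ ∀ y ∈ K, f y < u → y ∈ U := by
  have key : ∃ C : Set E, IsCompact C ∧ Convex ℝ C ∧ C ⊆ K ∧ x ∉ C ∧ K \ U ⊆ C := by
    refine IsCompact.induction_on (p := fun s => ∃ C : Set E, IsCompact C ∧ Convex ℝ C ∧ C ⊆ K ∧ x ∉ C ∧ s ⊆ C)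
      (hK.diff hU) ?_ ?_ ?_ ?_
    · exact ⟨∅, isCompact_empty, convex_empty, by simp, by simp, by simp⟩
    · rintro s t hst ⟨C, h1, h2, h3, h4, h5⟩
      exact ⟨C, h1, h2, h3, h4, hst.trans h5⟩
    · rintro s t ⟨C, h1, h2, h3, h4, h5⟩ ⟨D, k1, k2, k3, k4, k5⟩
      rcases C.eq_empty_or_nonempty with rfl | hC
      · exact ⟨D, k1, k2, k3, k4, Set.union_subset (h5.trans (by simp)) k5⟩
      rcases D.eq_empty_or_nonempty with rfl | hD
      · exact ⟨C, h1, h2, h3, h4, Set.union_subset h5 (k5.trans (by simp))⟩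
      refine ⟨convexJoin ℝ C D, ?_, h2.convexJoin k2, convexJoin_subset h3 k3 hKc, ?_, 
        Set.union_subset (h5.trans (subset_convexJoin_left hD)) (k5.trans (subset_convexJoin_right hC))⟩
      · have : convexJoin ℝ C D = (fun q : ℝ × E × E => (1 - q.1) • q.2.1 + q.1 • q.2.2) '' 
            (Set.Icc (0:ℝ) 1 ×ˢ (C ×ˢ D)) := by
          ext z
          simp only [mem_convexJoin, segment_eq_image, Set.mem_image, Set.mem_prod, Prod.exists]
          constructor
          · rintro ⟨a, ha, b, hb, θ, hθ, rfl⟩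
            exact ⟨θ, a, b, ⟨hθ, ha, hb⟩, rfl⟩
          · rintro ⟨θ, a, b, ⟨hθ, ha, hb⟩, rfl⟩
            exact ⟨a, ha, b, hb, θ, hθ, rfl⟩
        rw [this]
        exact (isCompact_Icc.prod (h1.prod k1)).image (by fun_prop)
      · rw [mem_convexJoin]
        rintro ⟨a, ha, b, hb, hab⟩
        rcases (mem_extremePoints_iff_forall_segment.1 hx).2 a (h3 ha) b (k3 hb) hab with h | h
        · exact h4 (h ▸ ha)
        · exact k4 (h ▸ hb)
    · rintro y ⟨hyK, hyU⟩
      have hne : x ≠ y := fun h => hyU (h ▸ hxU)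
      obtain ⟨f, hf⟩ := geometric_hahn_banach_point_point hne
      obtain ⟨r, hr1, hr2⟩ := exists_between hf
      refine ⟨{z | r < f z} ∩ (K \ U), Filter.inter_mem (mem_nhdsWithin_of_mem_nhds
        ((isOpen_lt continuous_const f.continuous).mem_nhds hr2)) self_mem_nhdsWithin,
        K ∩ {z | r ≤ f z}, hK.inter_right (isClosed_le continuous_const f.continuous),
        hKc.inter (convex_halfSpace_ge f.toLinearMap.isLinear r), Set.inter_subset_left,
        fun h => not_le.2 hr1 h.2, fun z hz => ⟨hz.2.1, le_of_lt (show r < f z from hz.1)⟩⟩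
  obtain ⟨C, h1, h2, h3, h4, h5⟩ := key
  obtain ⟨f, u, hu, hf⟩ := geometric_hahn_banach_point_closed h2 h1.isClosed h4
  refine ⟨f, u, hu, fun y hy hyu => ?_⟩
  by_contra hyU
  exact absurd (hf y (h5 ⟨hy, hyU⟩)) (not_lt.2 hyu.le)

theorem weak_compact_ball (r : ℝ) : IsCompact ((toWeakSpace ℝ V).symm ⁻¹' Metric.closedBall (0:V) r) := by
  have hcl : IsClosed ((toWeakSpace ℝ V).symm ⁻¹' Metric.closedBall (0:V) r) := by
    have := Convex.toWeakSpace_closure ℝ (convex_closedBall (0:V) r)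
    rw [Metric.isClosed_closedBall.closure_eq] at this
    rw [← LinearEquiv.image_eq_preimage_symm, this]
    exact isClosed_closure
  rw [← hcl.closure_eq]
  apply NormedSpace.isCompact_closure_of_isBounded
  · exact Metric.isBounded_closedBall
  · rintro F -
    let F' : StrongDual ℝ V := (WeakDual.toStrongDual F).comp (innerSL ℝ)
    refine ⟨toWeakSpace ℝ V ((InnerProductSpace.toDual ℝ V).symm F'), ?_⟩
    refine DFunLike.ext _ _ fun l => ?_
    obtain ⟨y, rfl⟩ := (InnerProductSpace.toDual ℝ V).surjective l
    have : (inner ℝ ((InnerProductSpace.toDual ℝ V).symm F') y : ℝ) = F' y := by simp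
    rw [real_inner_comm] at this
    exact this

theorem weak_closed {s : Set V} (hs : IsClosed s) (hc : Convex ℝ s) : IsClosed ((toWeakSpace ℝ V).symm ⁻¹' s) := by
  have := Convex.toWeakSpace_closure ℝ hc
  rw [hs.closure_eq] at this
  rw [← LinearEquiv.image_eq_preimage_symm, this]
  exact isClosed_closure

theorem lcweak : LocallyConvexSpace ℝ (WeakSpace ℝ V) :=
  inferInstanceAs (LocallyConvexSpace ℝ (WeakBilin (topDualPairing ℝ V).flip))

theorem convEnv_convex (g : V → EReal) : ERealConvex (convEnv g) := by
  intro x y a b ha hb hab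
  refine iSup_le fun h => (h.2.2.1 x y a b ha hb hab).trans ?_
  have h1 : h.1 x ≤ convEnv g x :=
    le_iSup (fun h : {h : V → EReal // LowerSemicontinuous h ∧ ERealConvex h ∧ ∀ z, h z ≤ g z} => h.1 x) h
  have h2 : h.1 y ≤ convEnv g y :=
    le_iSup (fun h : {h : V → EReal // LowerSemicontinuous h ∧ ERealConvex h ∧ ∀ z, h z ≤ g z} => h.1 y) h
  have ha' : (0:EReal) ≤ a := by exact_mod_cast ha
  have hb' : (0:EReal) ≤ b := by exact_mod_cast hb
  gcongr

theorem convEnv_lsc (g : V → EReal) : LowerSemicontinuous (convEnv g) :=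
  lowerSemicontinuous_iSup fun h => h.2.1

theorem convEnv_le (g : V → EReal) (x : V) : convEnv g x ≤ g x :=
  iSup_le fun h => h.2.2.2 x

theorem le_convEnv (g h : V → EReal) (h1 : LowerSemicontinuous h) (h2 : ERealConvex h)
    (h3 : ∀ z, h z ≤ g z) (x : V) : h x ≤ convEnv g x :=
  le_iSup (fun h : {h : V → EReal // LowerSemicontinuous h ∧ ERealConvex h ∧ ∀ z, h z ≤ g z} => h.1 x) ⟨h, h1, h2, h3⟩

theorem bot_all {G : V → EReal} (hG : ERealConvex G) (hl : LowerSemicontinuous G) {y : V}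
    (hy : G y = ⊥) (z : V) : G z = ⊥ := by
  by_contra hz
  have h1 : ∀ᶠ w in nhds z, ⊥ < G w := hl z ⊥ (bot_lt_iff_ne_bot.2 hz)
  have h2 : Filter.Tendsto (fun a : ℝ => a • y + (1 - a) • z) (nhdsWithin 0 (Set.Ioi 0)) (nhds z) := by
    have : Continuous (fun a : ℝ => a • y + (1 - a) • z) := by fun_prop
    have h := this.tendsto 0
    simp only [zero_smul, sub_zero, one_smul, zero_add] at h
    exact h.mono_left nhdsWithin_le_nhds
  have h3 := h2.eventually h1
  have h4 : ∀ᶠ a : ℝ in nhdsWithin 0 (Set.Ioi 0), a ∈ Set.Ioo (0:ℝ) 1 :=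
    Ioo_mem_nhdsGT one_pos
  obtain ⟨a, ha, ha0, ha1⟩ := (h3.and h4).exists
  have h5 := hG y z a (1 - a) ha0.le (by linarith) (by ring)
  rw [hy, EReal.coe_mul_bot_of_pos ha0, EReal.bot_add] at h5
  exact absurd ha (not_lt.2 h5)

theorem convEnv_ne_bot (g : V → EReal) (hproper : ∀ x, g x ≠ ⊥) (hcoer : Coercive (convEnv g))
    (y : V) : convEnv g y ≠ ⊥ := by
  intro hy
  have hall := bot_all (convEnv_convex g) (convEnv_lsc g) hy
  have hsub : Subsingleton V := by
    by_contra hn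
    have : Nontrivial V := not_subsingleton_iff_nontrivial.1 hn
    have hb := hcoer 0
    have hu : {x : V | convEnv g x ≤ ((0:ℝ) : EReal)} = Set.univ := by
      ext x; simp [hall x]
    rw [hu] at hb
    exact NormedSpace.unbounded_univ ℝ V hb
  have hg : g y ≤ convEnv g y := by
    refine le_convEnv g g ?_ ?_ (fun _ => le_rfl) y
    · intro x c hc
      exact Filter.Eventually.of_forall fun z => by rwa [Subsingleton.elim z x]
    · intro x z a b ha hb hab
      rw [Subsingleton.elim (a • x + b • z) x, Subsingleton.elim z x,
        ← EReal.right_distrib_of_nonneg (by exact_mod_cast ha) (by exact_mod_cast hb),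
        ← EReal.coe_add, hab, EReal.coe_one, one_mul]
  rw [hy] at hg
  exact hproper y (le_bot_iff.1 hg)

theorem conv_real {G : V → EReal} (hG : ERealConvex G) {p q : V} {u v a b : ℝ}
    (hp : G p ≤ (u : EReal)) (hq : G q ≤ (v : EReal)) (ha : 0 ≤ a) (hb : 0 ≤ b) (hab : a + b = 1) :
    G (a • p + b • q) ≤ ((a * u + b * v : ℝ) : EReal) := by
  refine (hG p q a b ha hb hab).trans ?_
  have ha' : (0:EReal) ≤ a := by exact_mod_cast ha
  have hb' : (0:EReal) ≤ b := by exact_mod_cast hb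
  rw [EReal.coe_add, EReal.coe_mul, EReal.coe_mul]
  gcongr

theorem ext_aux {G : V → EReal} (hG : ERealConvex G) (hbot : ∀ x, G x ≠ ⊥) {x y z : V}
    {s t a b : ℝ} (ha : 0 < a) (hb : 0 < b) (hab : a + b = 1) (hyz : y ≠ z)
    (hy : G y ≤ (s : EReal)) (hz : G z ≤ (t : EReal)) (hxe : x = a • y + b • z)
    (hx : G x = ((a * s + b * t : ℝ) : EReal)) :
    ∃ ν : V, ‖ν‖ = 1 ∧ ∃ t₀ : ℝ, 0 < t₀ ∧ ∃ a b : ℝ,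
      ∀ t ∈ Set.Ioo (-t₀) t₀, G (x + t • ν) = ((a + b * t : ℝ) : EReal) := by
  have hd : 0 < ‖z - y‖ := norm_pos_iff.2 (sub_ne_zero.2 hyz.symm)
  set d := ‖z - y‖ with hddef
  have hanum : a = 1 - b := by linarith
  refine ⟨d⁻¹ • (z - y), ?_, min a b * d, by positivity, a * s + b * t, (t - s) / d, ?_⟩
  · rw [norm_smul, norm_inv, norm_norm, ← hddef]; field_simp
  rintro τ ⟨h1, h2⟩
  obtain ⟨θ, hθ⟩ : ∃ θ, θ = b + τ / d := ⟨_, rfl⟩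
  have hτ : τ = (θ - b) * d := by rw [hθ]; field_simp; ring
  have hθ0 : 0 < θ := by
    have : -b * d < (θ - b) * d := by
      rw [← hτ]; nlinarith [min_le_right a b]
    have := lt_of_mul_lt_mul_right this hd.le
    linarith
  have hθ1 : θ < 1 := by
    have : (θ - b) * d < a * d := by
      rw [← hτ]; nlinarith [min_le_left a b]
    have := lt_of_mul_lt_mul_right this hd.le
    linarith
  have hw : x + τ • d⁻¹ • (z - y) = (1 - θ) • y + θ • z := by
    have : τ • d⁻¹ • (z - y) = (θ - b) • (z - y) := by
      rw [smul_smul, hτ]; congr 1; field_simp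
    rw [this, hxe, hanum]; module
  have hL : a * s + b * t + (t - s) / d * τ = (1 - θ) * s + θ * t := by
    rw [hτ, hanum]; field_simp; ring
  rw [hw, hL]
  have hup : G ((1 - θ) • y + θ • z) ≤ (((1 - θ) * s + θ * t : ℝ) : EReal) :=
    conv_real hG hy hz (by linarith) hθ0.le (by ring)
  obtain ⟨v, hv⟩ : ∃ v : ℝ, G ((1 - θ) • y + θ • z) = (v : EReal) :=
    ⟨_, (EReal.coe_toReal (ne_top_of_le_ne_top (EReal.coe_ne_top _) hup) (hbot _)).symm⟩
  refine le_antisymm hup ?_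
  rw [hv, EReal.coe_le_coe_iff]
  rcases le_total b θ with hle | hle
  · have hc : x = (1 - b / θ) • y + (b / θ) • ((1 - θ) • y + θ • z) := by
      rw [smul_add, smul_smul, smul_smul, ← add_assoc, ← add_smul, hxe, hanum]
      congr 2 <;> field_simp
      ring
    have h := conv_real hG hy hv.le (a := 1 - b / θ) (b := b / θ)
      (by rw [sub_nonneg, div_le_one hθ0]; exact hle) (by positivity) (by ring)
    rw [← hc, hx, EReal.coe_le_coe_iff] at h
    have h' : (a * s + b * t) * θ ≤ ((1 - b / θ) * s + b / θ * v) * θ := by gcongr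
    have e : ((1 - b / θ) * s + b / θ * v) * θ = (θ - b) * s + b * v := by field_simp
    rw [e, hanum] at h'
    have : b * ((1 - θ) * s + θ * t) ≤ b * v := by nlinarith
    exact le_of_mul_le_mul_left this hb
  · have h1θ : 0 < 1 - θ := by linarith
    have hc : x = (a / (1 - θ)) • ((1 - θ) • y + θ • z) + (1 - a / (1 - θ)) • z := by
      rw [smul_add, smul_smul, smul_smul, add_assoc, ← add_smul, hxe, hanum]
      congr 2 <;> field_simp
      ring
    have h := conv_real hG hv.le hz (a := a / (1 - θ)) (b := 1 - a / (1 - θ))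
      (by positivity) (by rw [sub_nonneg, div_le_one h1θ]; linarith)  (by ring)
    rw [← hc, hx, EReal.coe_le_coe_iff] at h
    have h' : (a * s + b * t) * (1 - θ) ≤ (a / (1 - θ) * v + (1 - a / (1 - θ)) * t) * (1 - θ) := by
      gcongr
    have e : (a / (1 - θ) * v + (1 - a / (1 - θ)) * t) * (1 - θ) = a * v + (1 - θ - a) * t := by
      field_simp
    rw [e] at h'
    have hb' : b = 1 - a := by linarith
    rw [hb'] at h'
    have : a * ((1 - θ) * s + θ * t) ≤ a * v := by nlinarith
    exact le_of_mul_le_mul_left this ha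

theorem stmt_9 (g : V → EReal) (hproper : ∀ x, g x ≠ ⊥) (hwlsc : WeaklyLSC g)
    (hcoer : Coercive (convEnv g)) (x : V) (hfin : convEnv g x ≠ ⊤)
    (hext : ¬ ∃ ν : V, ‖ν‖ = 1 ∧ ∃ t₀ : ℝ, 0 < t₀ ∧ ∃ a b : ℝ,
      ∀ t ∈ Set.Ioo (-t₀) t₀, convEnv g (x + t • ν) = ((a + b * t : ℝ) : EReal)) :
    g x = convEnv g x := by
  have hbot := convEnv_ne_bot g hproper hcoer
  have hconv := convEnv_convex g
  have hlsc := convEnv_lsc g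
  have hle := convEnv_le g
  have hmax := le_convEnv g
  generalize convEnv g = G at *
  have := t2weak (V := V)
  have := lcweak (V := V)
  by_contra hne
  have hlt : G x < g x := lt_of_le_of_ne (hle x) (Ne.symm hne)
  obtain ⟨m, hm⟩ : ∃ m : ℝ, G x = (m : EReal) := ⟨_, (EReal.coe_toReal hfin (hbot x)).symm⟩
  obtain ⟨c, hc1, hc2⟩ : ∃ c : ℝ, G x < (c : EReal) ∧ (c : EReal) < g x := EReal.lt_iff_exists_real_btwn.1 hlt
  have hmc : m < c := by rw [hm] at hc1; exact_mod_cast hc1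
  let e : WeakSpace ℝ V ≃ₗ[ℝ] V := (toWeakSpace ℝ V).symm
  -- weak lower semicontinuity of the envelope
  have hGw : LowerSemicontinuous (fun w : WeakSpace ℝ V => G (e w)) := by
    rw [lowerSemicontinuous_iff_isClosed_preimage]
    intro r
    have h1 : IsClosed (G ⁻¹' Set.Iic r) := hlsc.isClosed_preimage r
    refine weak_closed h1 ?_
    intro p hp q hq a b ha hb hab
    refine (hconv p q a b ha hb hab).trans ?_
    have ha' : (0:EReal) ≤ a := by exact_mod_cast ha
    have hb' : (0:EReal) ≤ b := by exact_mod_cast hb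
    calc (a : EReal) * G p + b * G q ≤ a * r + b * r := by
          have hp' : G p ≤ r := hp
          have hq' : G q ≤ r := hq
          gcongr
      _ = r := by
          rw [← EReal.right_distrib_of_nonneg ha' hb', ← EReal.coe_add, hab, EReal.coe_one, one_mul]
  -- the truncated epigraph
  let K : Set (WeakSpace ℝ V × ℝ) := {p | G (e p.1) ≤ (p.2 : EReal) ∧ p.2 ≤ c + 1}
  have hKcl : IsClosed K := by
    have h1 : IsClosed {p : WeakSpace ℝ V × ℝ | G (e p.1) ≤ (p.2 : EReal)} :=
      hGw.isClosed_epigraph.preimage (f := fun p : WeakSpace ℝ V × ℝ => (p.1, (p.2 : EReal)))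
        (continuous_fst.prodMk (continuous_coe_real_ereal.comp continuous_snd))
    exact h1.inter (isClosed_le continuous_snd continuous_const)
  have hKconv : Convex ℝ K := by
    rintro p ⟨hp1, hp2⟩ q ⟨hq1, hq2⟩ a b ha hb hab
    refine ⟨?_, ?_⟩
    · have := conv_real hconv hp1 hq1 ha hb hab
      simpa using this
    · have h1 : a * p.2 + b * q.2 ≤ a * (c + 1) + b * (c + 1) := by gcongr
      have h2 : a * (c + 1) + b * (c + 1) = c + 1 := by rw [← add_mul, hab, one_mul]
      have : (a • p + b • q).2 = a * p.2 + b * q.2 := by simp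
      rw [this]; linarith
  have hxK : (toWeakSpace ℝ V x, m) ∈ K := ⟨hm.le, by simp; linarith⟩
  have hKcomp : IsCompact K := by
    obtain ⟨r, hr⟩ := (hcoer (c + 1)).subset_closedBall 0
    have hB := weak_compact_ball (V := V) r
    have hmem : ∀ p ∈ K, p.1 ∈ (toWeakSpace ℝ V).symm ⁻¹' Metric.closedBall (0:V) r := by
      rintro p ⟨hp1, hp2⟩
      exact hr (hp1.trans (by exact_mod_cast hp2))
    obtain ⟨w, hw, hwmin⟩ := LowerSemicontinuousOn.exists_isMinOn ⟨_, hmem _ hxK⟩ hB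
      (hGw.lowerSemicontinuousOn _)
    obtain ⟨l, hl⟩ : ∃ l : ℝ, G (e w) = (l : EReal) := by
      refine ⟨_, (EReal.coe_toReal ?_ (hbot _)).symm⟩
      have h1 : G (e w) ≤ G x := hwmin (hmem _ hxK)
      exact ne_top_of_le_ne_top hfin h1
    refine (hB.prod (isCompact_Icc (a := l) (b := c + 1))).of_isClosed_subset hKcl ?_
    rintro p hp
    refine ⟨hmem p hp, ?_, hp.2⟩
    have h1 : G (e w) ≤ G (e p.1) := hwmin (hmem p hp)
    have h2 := h1.trans hp.1
    rw [hl] at h2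
    exact_mod_cast h2
  have hxext : (toWeakSpace ℝ V x, m) ∈ K.extremePoints ℝ := by
    rw [mem_extremePoints]
    refine ⟨hxK, ?_⟩
    rintro ⟨y, s⟩ ⟨hy, -⟩ ⟨z, t⟩ ⟨hz, -⟩ ⟨a, b, ha, hb, hab, hxe⟩
    simp only [Prod.smul_mk, Prod.mk_add_mk, Prod.mk.injEq, smul_eq_mul] at hxe hy hz
    obtain ⟨hxe1, hxe2⟩ := hxe
    have hx' : x = a • e y + b • e z := by
      have := congrArg e hxe1
      simpa [e] using this.symm
    by_cases hyz : e y = e z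
    · have hyx : e y = x := by rw [hx', ← hyz, ← add_smul, hab, one_smul]
      have hzx : e z = x := by rw [← hyz, hyx]
      rw [hyx, hm, EReal.coe_le_coe_iff] at hy
      rw [hzx, hm, EReal.coe_le_coe_iff] at hz
      have e1 : y = toWeakSpace ℝ V x := hyx
      have e2 : z = toWeakSpace ℝ V x := hzx
      have hm' : m = a * m + b * m := by rw [← add_mul, hab, one_mul]
      have hs : s = m := by
        refine le_antisymm ?_ hy
        have : a * s ≤ a * m := by nlinarith
        exact le_of_mul_le_mul_left this ha
      have ht : t = m := by
        refine le_antisymm ?_ hz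
        have : b * t ≤ b * m := by nlinarith
        exact le_of_mul_le_mul_left this hb
      rw [e1, e2, hs, ht]; exact ⟨rfl, rfl⟩
    · exact absurd (ext_aux hconv hbot ha hb hab hyz hy hz hx' (by rw [hm, hxe2])) hext
  -- the neighbourhood
  let W : Set (WeakSpace ℝ V) := {w | (c : EReal) < g (e w)}
  have hW : IsOpen W := by
    have h := hwlsc.isOpen_preimage (c : EReal)
    exact h
  obtain ⟨f, u, hfu, hslice⟩ := choquet_slice hKcomp hKconv hxext
    (hW.prod (isOpen_Iio (a := c))) ⟨hc2, hmc⟩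
  -- the slice of the full epigraph
  have hfull : ∀ y : V, ∀ s : ℝ, G y ≤ (s : EReal) → f (toWeakSpace ℝ V y, s) < u →
      (c : EReal) < g y ∧ s < c := by
    intro y s hy hf
    by_cases hs : s ≤ c + 1
    · exact hslice (toWeakSpace ℝ V y, s) ⟨hy, hs⟩ hf
    · exfalso
      push Not at hs
      have hsm : 0 < s - m := by linarith
      obtain ⟨θ, hθ⟩ : ∃ θ, θ = (c + 1 - m) / (s - m) := ⟨_, rfl⟩
      have hθ0 : 0 < θ := by rw [hθ]; apply div_pos <;> linarith
      have hθ1 : θ < 1 := by rw [hθ, div_lt_one hsm]; linarith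
      have hlev : (1 - θ) * m + θ * s = c + 1 := by rw [hθ]; field_simp; ring
      have hq := conv_real hconv hm.le hy (by linarith : 0 ≤ 1 - θ) hθ0.le (by ring)
      have hfe : f ((1 - θ) • (toWeakSpace ℝ V x, m) + θ • (toWeakSpace ℝ V y, s)) < u := by
        rw [map_add, map_smul, map_smul, smul_eq_mul, smul_eq_mul]
        nlinarith
      have hpe : (1 - θ) • (toWeakSpace ℝ V x, m) + θ • (toWeakSpace ℝ V y, s)
          = (toWeakSpace ℝ V ((1 - θ) • x + θ • y), c + 1) := by
        simp [← hlev]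
      rw [hpe] at hfe
      rw [hlev] at hq
      have hlast : c + 1 < c :=
        (hslice (toWeakSpace ℝ V ((1 - θ) • x + θ • y), c + 1) ⟨hq, le_rfl⟩ hfe).2
      linarith
  have hsplit : ∀ y : V, ∀ s : ℝ, f (toWeakSpace ℝ V y, s)
      = f (toWeakSpace ℝ V y, 0) + s * f (0, 1) := by
    intro y s
    rw [← smul_eq_mul, ← map_smul, ← map_add]; simp
  have hq : 0 < f (0, 1) := by
    by_contra hq
    push Not at hq
    have h1 : f (toWeakSpace ℝ V x, c) < u := by
      rw [hsplit] at hfu ⊢; nlinarith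
    exact lt_irrefl _ (hfull x c hc1.le h1).2
  set q := f (0, 1) with hqdef
  let h : V → ℝ := fun y => (u - f (toWeakSpace ℝ V y, 0)) / q
  have hcont : Continuous h := by
    have h1 : Continuous (fun y : V => toWeakSpace ℝ V y) := (toWeakSpaceCLM ℝ V).continuous
    have h2 : Continuous (fun y : V => f (toWeakSpace ℝ V y, 0)) :=
      f.continuous.comp (h1.prodMk continuous_const)
    exact (continuous_const.sub h2).div_const q
  have hfinal := hmax (fun y => (h y : EReal))
    (continuous_coe_real_ereal.comp hcont).lowerSemicontinuous ?_ ?_ x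
  · rw [hm, EReal.coe_le_coe_iff] at hfinal
    rw [hsplit] at hfu
    have : (u - f (toWeakSpace ℝ V x, 0)) / q ≤ m := hfinal
    rw [div_le_iff₀ hq] at this
    linarith
  · intro y z a b ha hb hab
    rw [← EReal.coe_mul, ← EReal.coe_mul, ← EReal.coe_add, EReal.coe_le_coe_iff]
    apply le_of_eq
    have h1 : f (toWeakSpace ℝ V (a • y + b • z), 0)
        = a * f (toWeakSpace ℝ V y, 0) + b * f (toWeakSpace ℝ V z, 0) := by
      rw [← smul_eq_mul, ← smul_eq_mul, ← map_smul, ← map_smul, ← map_add]; simp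
    have hb' : b = 1 - a := by linarith
    simp only [h, h1]
    rw [hb']; field_simp; ring
  · intro y
    by_contra hlt'
    push Not at hlt'
    obtain ⟨s, hs⟩ : ∃ s : ℝ, g y = (s : EReal) :=
      ⟨_, (EReal.coe_toReal (ne_top_of_lt hlt') (hproper y)).symm⟩
    rw [hs, EReal.coe_lt_coe_iff] at hlt'
    have h1 : f (toWeakSpace ℝ V y, s) < u := by
      rw [hsplit]
      have : s < (u - f (toWeakSpace ℝ V y, 0)) / q := hlt'
      rw [lt_div_iff₀ hq] at this
      linarith
    have h2 := hfull y s (by rw [← hs]; exact hle y) h1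
    rw [hs, EReal.coe_lt_coe_iff] at h2
    exact lt_asymm h2.1 h2.2
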